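/- arXiv:2107.09596 — 2 statements merged into one kernel-verified Lean document; each statement's English description precedes it below -/
import Mathlib

section
/- Let R be a ring, Φ ∈ R, and n ≥ 1, m ≥ 1 natural numbers. Let A be the (n·m)×(n·m) matrix over R with A i i = 1, A i j = −Φ when i = j + 1, and A i j = 0 otherwise. Let P be the (n·m)×n matrix with P i p = Φ^(i mod m) if p = i div m and P i p = 0 otherwise, and let Rᵢ be the n×(n·m) matrix with Rᵢ p i = 1 if i = p·m and Rᵢ p i = 0 otherwise. Then Rᵢ·A·P is the n×n matrix with entries 1 on the diagonal, −Φ^m on the first subdiagonal (position (p, p−1) for p ≥ 1), and 0 elsewhere. -/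
open Matrix

/-- The ideal (Schur-complement) coarse-grid operator: if `A` is the all-at-once
space-time matrix with time integrator `Φ`, `P` is ideal interpolation and `Rᵢ` is
restriction by injection to the C-points (every `m`-th point), then `Rᵢ·A·P` is the
coarse all-at-once matrix with time step `Φ^m`. -/
theorem ideal_coarse_grid_operator {R : Type*} [Ring R] (Φ : R) (n m : ℕ)
    (hn : 1 ≤ n) (hm : 1 ≤ m)
    (A : Matrix (Fin (n * m)) (Fin (n * m)) R)
    (hA : ∀ i j : Fin (n * m),
      A i j = if i = j then 1 else if (i : ℕ) = (j : ℕ) + 1 then -Φ else 0)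
    (P : Matrix (Fin (n * m)) (Fin n) R)
    (hP : ∀ (i : Fin (n * m)) (p : Fin n),
      P i p = if (p : ℕ) = (i : ℕ) / m then Φ ^ ((i : ℕ) % m) else 0)
    (Ri : Matrix (Fin n) (Fin (n * m)) R)
    (hRi : ∀ (p : Fin n) (i : Fin (n * m)),
      Ri p i = if (i : ℕ) = (p : ℕ) * m then 1 else 0) :
    Ri * A * P = Matrix.of fun p q : Fin n =>
      if p = q then 1 else if (p : ℕ) = (q : ℕ) + 1 then -(Φ ^ m) else 0 := by
  have hpos : ∀ p : Fin n, (p : ℕ) * m < n * m := fun p => Nat.mul_lt_mul_of_pos_right p.2 hm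
  ext p q
  have hRow : (Ri * A * P) p q = ∑ j, A ⟨p * m, hpos p⟩ j * P j q := by
    rw [Matrix.mul_assoc, Matrix.mul_apply, Finset.sum_eq_single ⟨p * m, hpos p⟩]
    · simp [hRi, Matrix.mul_apply]
    · intro i _ hi
      rw [hRi, if_neg fun h => hi (Fin.ext h), zero_mul]
    · simp
  have hC : P ⟨p * m, hpos p⟩ q = if p = q then 1 else 0 := by
    simp [hP, Nat.mul_div_cancel _ hm, Fin.ext_iff, eq_comm]
  rw [hRow, Matrix.of_apply]
  rcases Nat.eq_zero_or_pos (p : ℕ) with hp | hp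
  · rw [Finset.sum_eq_single ⟨p * m, hpos p⟩, hA, if_pos rfl, one_mul, hC,
      if_neg (show ¬ (p : ℕ) = q + 1 by omega)]
    · intro j _ hj
      rw [hA, if_neg (Ne.symm hj), if_neg (by simp [hp]), zero_mul]
    · simp
  · obtain ⟨k, hk⟩ : ∃ k, (p : ℕ) = k + 1 := ⟨p - 1, by omega⟩
    have hkm : (p : ℕ) * m = k * m + (m - 1) + 1 := by
      rw [hk, Nat.succ_mul]
      omega
    have hlt : k * m + (m - 1) < n * m := by
      have := hpos p
      omega
    have hdiv : (k * m + (m - 1)) / m = k := by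
      rw [mul_comm, Nat.mul_add_div hm, Nat.div_eq_of_lt (by omega), add_zero]
    have hmod : (k * m + (m - 1)) % m = m - 1 := by
      rw [mul_comm, Nat.mul_add_mod, Nat.mod_eq_of_lt (by omega)]
    have hF : Φ * P ⟨k * m + (m - 1), hlt⟩ q = if (p : ℕ) = q + 1 then Φ ^ m else 0 := by
      simp only [hP, hdiv, hmod, hk, add_left_inj, mul_ite, mul_zero, ← pow_succ',
        Nat.sub_add_cancel hm, eq_comm]
    rw [Finset.sum_eq_add ⟨p * m, hpos p⟩ ⟨k * m + (m - 1), hlt⟩, hA, hA, if_pos rfl,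
      if_neg (by simp only [Fin.mk.injEq]; omega), if_pos hkm, one_mul, neg_mul, hC, hF]
    · by_cases hpq : p = q
      · simp [hpq]
      · simp only [if_neg hpq, zero_add]
        split_ifs <;> simp
    · simp only [ne_eq, Fin.mk.injEq]
      omega
    · rintro j - ⟨hj, hj'⟩
      rw [hA, if_neg (Ne.symm hj), if_neg, zero_mul]
      intro h
      exact hj' (Fin.ext (by simp only at h ⊢; omega))
    · simp
    · simp
end

section
/- Let R be a commutative ring, a, b, μ ∈ R, and n, k, ℓ natural numbers with k ≥ 1. Let T be the n×n matrix over R with entries T i j = a·μ^(i−j−1) if 1 ≤ i−j ≤ k−1, T i j = b if i−j = k, and T i j = 0 otherwise. If ℓ·k ≥ n, then every entry of T^ℓ lies in the ideal of R generated by a. -/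
open Matrix

/-- If, modulo the ideal `I`, a matrix is supported on its `k`-th subdiagonal, then, modulo `I`,
its `l`-th power is supported on the `l * k`-th subdiagonal. -/
theorem pow_apply_mem_of_ne_add_mul {R : Type*} [CommRing R] {n k : ℕ} (I : Ideal R)
    (T : Matrix (Fin n) (Fin n) R)
    (hT : ∀ i j : Fin n, (i : ℕ) ≠ j + k → T i j ∈ I) (l : ℕ) :
    ∀ i j : Fin n, (i : ℕ) ≠ j + l * k → (T ^ l) i j ∈ I := by
  induction l with
  | zero =>
    intro i j hij
    have hne : i ≠ j := by
      rintro rfl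
      simp at hij
    simp [Matrix.one_apply_ne hne]
  | succ l ih =>
    intro i j hij
    rw [pow_succ, Matrix.mul_apply]
    refine I.sum_mem fun x _ => ?_
    by_cases hx : (x : ℕ) = j + k
    · exact I.mul_mem_right _ (ih i x fun h => hij (by rw [h, hx]; ring))
    · exact I.mul_mem_left _ (hT x j hx)

/-- After `ℓ` iterations with `ℓ·k ≥ n`, every entry of the `ℓ`-th power of the AT-MGRIT
C-point error propagator carries at least one factor of the defect `a = λ^m − μ`:
each entry of `T^ℓ` lies in the ideal generated by `a`. -/
theorem at_mgrit_pow_entries_in_ideal {R : Type*} [CommRing R] (a b mu : R)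
    (n k l : ℕ) (hk : 1 ≤ k)
    (T : Matrix (Fin n) (Fin n) R)
    (hT : ∀ i j : Fin n,
      T i j =
        if 1 ≤ (i : ℕ) - (j : ℕ) ∧ (i : ℕ) - (j : ℕ) ≤ k - 1 then
          a * mu ^ ((i : ℕ) - (j : ℕ) - 1)
        else if (i : ℕ) - (j : ℕ) = k then b else 0)
    (hl : n ≤ l * k) :
    ∀ i j : Fin n, (T ^ l) i j ∈ Ideal.span {a} := by
  intro i j
  refine pow_apply_mem_of_ne_add_mul (k := k) _ T (fun i j hij => ?_) l i j (by omega)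
  rw [hT, if_neg (show ¬ (i : ℕ) - (j : ℕ) = k by omega)]
  split_ifs
  · exact Ideal.mul_mem_right _ _ (Ideal.mem_span_singleton_self a)
  · exact Ideal.zero_mem _
end
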